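/- arXiv:1805.10646 — 2 statements merged into one kernel-verified Lean document; each statement's English description precedes it below -/
import Mathlib

section
/- For a starlike tree with three branches x, y, z each of length n over a binary alphabet, the number of distinct non-empty palindromes is at most 4n - 1. -/
/-- `p` is a nonempty palindromic factor of `w`. -/
def PalIn (p w : List (Fin 2)) : Prop := p ≠ [] ∧ p.reverse = p ∧ p <:+: w

/-- Appending one letter adds at most one palindrome. -/
theorem palIn_step (w : List (Fin 2)) (c : Fin 2) :
    ∃ q, ∀ p, PalIn p (w ++ [c]) → PalIn p w ∨ p = q := by
  classical
  let S : Set (List (Fin 2)) := {q | q ≠ [] ∧ q.reverse = q ∧ q <:+ w ++ [c]}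
  have hne : ∃ k, ∃ q ∈ S, (w ++ [c]).length - q.length = k :=
    ⟨_, [c], ⟨by simp, by simp, by simp⟩, rfl⟩
  obtain ⟨q, ⟨hq0, hqr, hqs⟩, hk⟩ := Nat.find_spec hne
  refine ⟨q, ?_⟩
  rintro p ⟨hp0, hpr, hpi⟩
  by_cases hpw : p <:+: w
  · exact Or.inl ⟨hp0, hpr, hpw⟩
  have hps : p <:+ w ++ [c] := by
    obtain ⟨s, t, h⟩ := hpi
    rcases List.eq_nil_or_concat t with rfl | ⟨t', d, rfl⟩
    · exact ⟨s, by simpa using h⟩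
    · exfalso
      apply hpw
      rw [List.concat_eq_append, ← List.append_assoc] at h
      exact ⟨s, t', (List.append_inj' h rfl).1⟩
  have hle : p.length ≤ q.length := by
    have h1 := Nat.find_min' hne ⟨p, ⟨hp0, hpr, hps⟩, rfl⟩
    have := hps.length_le
    have := hqs.length_le
    omega
  have hpq : p <:+ q := List.suffix_of_suffix_length_le hps hqs hle
  have hpre : p <+: q := by
    rw [← List.reverse_suffix, hpr, hqr]; exact hpq
  obtain ⟨r, hr⟩ := hpre
  rcases List.eq_nil_or_concat r with rfl | ⟨r', d, rfl⟩
  · right; simpa using hr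
  · exfalso
    apply hpw
    obtain ⟨u, hu⟩ := hqs
    rw [← hr, List.concat_eq_append, ← List.append_assoc, ← List.append_assoc] at hu
    exact ⟨u, r', by simpa using (List.append_inj' hu rfl).1⟩

theorem palIn_append (u v : List (Fin 2)) :
    ∃ F : Finset (List (Fin 2)), F.card ≤ v.length ∧
      ∀ p, PalIn p (u ++ v) → PalIn p u ∨ p ∈ F := by
  classical
  induction v using List.reverseRecOn with
  | nil => exact ⟨∅, by simp, by simp⟩
  | append_singleton v c ih =>
    obtain ⟨F, hF, h⟩ := ih
    obtain ⟨q, hq⟩ := palIn_step (u ++ v) c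
    refine ⟨insert q F, ?_, ?_⟩
    · have := Finset.card_insert_le q F
      simp only [List.length_append, List.length_singleton]
      omega
    · intro p hp
      rw [← List.append_assoc] at hp
      rcases hq p hp with h1 | rfl
      · rcases h p h1 with h2 | h2
        · exact Or.inl h2
        · exact Or.inr (Finset.mem_insert_of_mem h2)
      · exact Or.inr (Finset.mem_insert_self _ _)

theorem palIn_reverse {p w : List (Fin 2)} (h : PalIn p w) : PalIn p w.reverse := by
  obtain ⟨h0, h1, h2⟩ := h
  refine ⟨h0, h1, ?_⟩
  rw [← h1]
  exact List.reverse_infix.mpr h2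

theorem palIn_swap {p x y : List (Fin 2)} (h : PalIn p (x.reverse ++ y)) :
    PalIn p (y.reverse ++ x) := by
  simpa using palIn_reverse h

theorem palIn_mono {p v w : List (Fin 2)} (h : PalIn p v) (hvw : v <:+: w) : PalIn p w :=
  ⟨h.1, h.2.1, h.2.2.trans hvw⟩

/-- The case where two branches begin with the same letter. -/
theorem star_main (n : ℕ) (a : Fin 2) (x y z : List (Fin 2))
    (hx : x.length = n) (hy : y.length = n + 1) (hz : z.length = n) :
    ∃ F : Finset (List (Fin 2)), F.card ≤ 4 * (n + 1) - 1 ∧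
      ∀ p, (PalIn p ((a :: x).reverse ++ y) ∨ PalIn p ((a :: x).reverse ++ (a :: z)) ∨
        PalIn p (y.reverse ++ (a :: z))) → p ∈ F := by
  classical
  obtain ⟨F1, c1, h1⟩ := palIn_append [] ((a :: x).reverse ++ y)
  obtain ⟨F2, c2, h2⟩ := palIn_append (a :: x).reverse (a :: z)
  obtain ⟨F3, c3, h3⟩ := palIn_append (y.reverse ++ [a]) z
  have k1 : ∀ p, PalIn p ((a :: x).reverse ++ y) → p ∈ F1 := by
    intro p hp
    rcases h1 p hp with h | h
    · exact absurd (List.infix_nil.mp h.2.2) h.1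
    · exact h
  refine ⟨F1 ∪ F2 ∪ F3, ?_, ?_⟩
  · have e1 := Finset.card_union_le (F1 ∪ F2) F3
    have e2 := Finset.card_union_le F1 F2
    simp only [List.length_append, List.length_reverse, List.length_cons] at c1 c2
    omega
  · intro p hp
    simp only [Finset.mem_union]
    rcases hp with h | h | h
    · exact Or.inl (Or.inl (k1 p h))
    · rcases h2 p h with h' | h'
      · exact Or.inl (Or.inl (k1 p (palIn_mono h' ⟨[], y, by simp⟩)))
      · exact Or.inl (Or.inr h')
    · rcases h3 p (by simpa using h) with h' | h'
      · refine Or.inl (Or.inl (k1 p (palIn_mono (palIn_reverse h') ⟨x.reverse, [], by simp⟩)))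
      · exact Or.inr h'

/-- For a starlike tree with three branches x, y, z each of length n over a binary
alphabet, the number of distinct non-empty palindromes is at most 4n - 1. -/
theorem stmt_9 (n : ℕ) (x y z : List (Fin 2))
    (hx : x.length = n) (hy : y.length = n) (hz : z.length = n) :
    {p : List (Fin 2) | p ≠ [] ∧ p.reverse = p ∧
        (p <:+: x.reverse ++ y ∨ p <:+: x.reverse ++ z ∨ p <:+: y.reverse ++ z)}.ncard ≤
      4 * n - 1 := by
  suffices H : ∃ F : Finset (List (Fin 2)), F.card ≤ 4 * n - 1 ∧
      ∀ p, (PalIn p (x.reverse ++ y) ∨ PalIn p (x.reverse ++ z) ∨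
        PalIn p (y.reverse ++ z)) → p ∈ F by
    obtain ⟨F, hF, h⟩ := H
    refine le_trans ?_ hF
    rw [← Set.ncard_coe_finset F]
    refine Set.ncard_le_ncard ?_ F.finite_toSet
    rintro p ⟨h0, hr, hp⟩
    refine h p ?_
    rcases hp with hp | hp | hp
    · exact Or.inl ⟨h0, hr, hp⟩
    · exact Or.inr (Or.inl ⟨h0, hr, hp⟩)
    · exact Or.inr (Or.inr ⟨h0, hr, hp⟩)
  rcases n with _ | n
  · obtain rfl := List.length_eq_zero_iff.mp hx
    obtain rfl := List.length_eq_zero_iff.mp hy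
    obtain rfl := List.length_eq_zero_iff.mp hz
    refine ⟨∅, by simp, ?_⟩
    intro p hp
    have hp' : PalIn p [] := by simpa using hp
    exact absurd (List.infix_nil.mp hp'.2.2) hp'.1
  obtain ⟨a, x', rfl⟩ := List.exists_cons_of_length_eq_add_one hx
  obtain ⟨b, y', rfl⟩ := List.exists_cons_of_length_eq_add_one hy
  obtain ⟨c, z', rfl⟩ := List.exists_cons_of_length_eq_add_one hz
  have hx' : x'.length = n := by simpa using hx
  have hy' : y'.length = n := by simpa using hy
  have hz' : z'.length = n := by simpa using hz
  have hpig : a = c ∨ a = b ∨ b = c := by omega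
  rcases hpig with rfl | rfl | rfl
  · exact star_main n a x' (b :: y') z' hx' hy hz'
  · obtain ⟨F, hF, h⟩ := star_main n a x' (c :: z') y' hx' hz hy'
    refine ⟨F, hF, fun p hp => h p ?_⟩
    rcases hp with hp | hp | hp
    · exact Or.inr (Or.inl hp)
    · exact Or.inl hp
    · exact Or.inr (Or.inr (palIn_swap hp))
  · obtain ⟨F, hF, h⟩ := star_main n b y' (a :: x') z' hy' hx hz'
    refine ⟨F, hF, fun p hp => h p ?_⟩
    rcases hp with hp | hp | hp
    · exact Or.inl (palIn_swap hp)
    · exact Or.inr (Or.inr hp)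
    · exact Or.inr (Or.inl hp)
end

section
/- Let x, y, z be words of length n with y[n] = z[n]. Then the number of distinct non-empty palindromes occurring as factors of at least one of R(x)y, R(y)z, R(x)z is at most 2n + n + (n-1) = 4n - 1. -/
/-- Non-empty palindromic factors of `w`. -/
def palSet {α : Type*} (w : List α) : Set (List α) :=
  {p | p ≠ [] ∧ p.reverse = p ∧ p <:+: w}

theorem palSet_finite {α : Type*} (w : List α) : (palSet w).Finite := by
  refine (List.finite_toSet w.sublists).subset ?_
  rintro p ⟨-, -, h⟩
  simpa using h.sublist

theorem palSet_mono {α : Type*} {u w : List α} (h : u <:+: w) : palSet u ⊆ palSet w :=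
  fun _ hp => ⟨hp.1, hp.2.1, hp.2.2.trans h⟩

theorem palSet_reverse {α : Type*} (w : List α) : palSet w.reverse = palSet w := by
  ext p
  constructor
  · rintro ⟨h1, h2, h3⟩
    refine ⟨h1, h2, ?_⟩
    rw [← h2] at h3
    exact List.reverse_infix.1 h3
  · rintro ⟨h1, h2, h3⟩
    refine ⟨h1, h2, ?_⟩
    rw [← h2]
    exact List.reverse_infix.2 h3

/-- Appending a letter adds at most the longest palindromic suffix. -/
theorem palSet_snoc {α : Type*} (w : List α) (c : α) :
    ∃ q : List α, q ≠ [] ∧ q.reverse = q ∧ q <:+ w ++ [c] ∧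
      palSet (w ++ [c]) ⊆ insert q (palSet w) := by
  classical
  let S : Set (List α) := {q | q ≠ [] ∧ q.reverse = q ∧ q <:+ w ++ [c]}
  have hS : S.Finite := (palSet_finite (w ++ [c])).subset
    (fun p hp => ⟨hp.1, hp.2.1, hp.2.2.isInfix⟩)
  have hne : S.Nonempty := ⟨[c], by simp, by simp, List.suffix_append _ _⟩
  obtain ⟨q, hq, hmax⟩ := hS.exists_maximalFor List.length S hne
  refine ⟨q, hq.1, hq.2.1, hq.2.2, ?_⟩
  rintro p ⟨h1, h2, h3⟩
  have h4 : p <:+ w ++ [c] ∨ p <:+: w := by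
    obtain ⟨s, t, hst⟩ := h3
    rcases List.eq_nil_or_concat' t with rfl | ⟨t', d, rfl⟩
    · left; exact ⟨s, by simpa using hst⟩
    · right
      rw [← List.append_assoc] at hst
      exact ⟨s, t', (List.append_inj' hst rfl).1⟩
  rcases h4 with h4 | h4
  · have hle : p.length ≤ q.length := by
      rcases le_total p.length q.length with h | h
      · exact h
      · exact hmax (j := p) ⟨h1, h2, h4⟩ h
    have hpq : p <:+ q := List.suffix_of_suffix_length_le h4 hq.2.2 hle
    have hpq' : p <+: q := by
      rw [← h2, ← hq.2.1]; exact List.reverse_prefix.2 hpq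
    obtain ⟨r, hr⟩ := hpq'
    rcases List.eq_nil_or_concat' r with rfl | ⟨r', d, rfl⟩
    · left; simpa using hr
    · right
      refine ⟨h1, h2, ?_⟩
      obtain ⟨s, hs⟩ := hq.2.2
      rw [← hr, ← List.append_assoc, ← List.append_assoc] at hs
      exact ⟨s, r', (List.append_inj' hs rfl).1⟩
  · right; exact ⟨h1, h2, h4⟩

theorem palSet_append {α : Type*} (S : Set (List α)) (hS : S.Finite) (t : List α) :
    ∀ u : List α, (S ∪ palSet (u ++ t)).ncard ≤ (S ∪ palSet u).ncard + t.length := by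
  induction t with
  | nil => intro u; simp
  | cons c t ih =>
    intro u
    have h1 := ih (u ++ [c])
    obtain ⟨q, -, -, -, hq⟩ := palSet_snoc u c
    have h2 : (S ∪ palSet (u ++ [c])).ncard ≤ (S ∪ palSet u).ncard + 1 := by
      refine le_trans (Set.ncard_le_ncard ?_ ((hS.union (palSet_finite u)).insert q))
        (Set.ncard_insert_le q _)
      intro p hp
      rcases hp with hp | hp
      · right; left; exact hp
      · rcases hq hp with h | h
        · left; exact h
        · right; right; exact h
    simp only [List.append_assoc, List.singleton_append, List.length_cons] at *
    omega

theorem palSet_append_of_subset {α : Type*} {S : Set (List α)} (hS : S.Finite)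
    {u : List α} (hu : palSet u ⊆ S) (t : List α) :
    (S ∪ palSet (u ++ t)).ncard ≤ S.ncard + t.length := by
  have := palSet_append S hS t u
  rwa [Set.union_eq_left.2 hu] at this

theorem palSet_ncard_append {α : Type*} (u t : List α) :
    (palSet (u ++ t)).ncard ≤ (palSet u).ncard + t.length := by
  simpa using palSet_append ∅ Set.finite_empty t u

theorem palSet_ncard_le {α : Type*} (w : List α) : (palSet w).ncard ≤ w.length := by
  have h := palSet_ncard_append [] w
  have : palSet ([] : List α) = ∅ := by
    ext p; simp [palSet]; tauto
  simpa [this] using h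

/-- A non-palindromic complete return to a letter makes the word non-rich. -/
theorem not_rich {α : Type*} (a : α) : ∀ (m : ℕ) (p s q : List α), p.length = m → a ∉ s →
    s.reverse ≠ s → (palSet (p ++ a :: s ++ a :: q)).ncard + 1 ≤
      (p ++ a :: s ++ a :: q).length := by
  intro m
  induction m using Nat.strong_induction_on with
  | _ m ih =>
  intro p s q hp has hs
  obtain ⟨P, hP1, hP2, ⟨p', hp'⟩, hsub⟩ := palSet_snoc (p ++ a :: s) a
  -- either the longest palindromic suffix is `[a]`, or it is long
  rcases lt_or_ge p'.length p.length with hlt | hge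
  · have hpp : p' <+: p := by
      have e1 : p' <+: p ++ (a :: s ++ [a]) := ⟨P, by simpa using hp'⟩
      exact List.prefix_of_prefix_length_le e1 (List.prefix_append _ _) hlt.le
    obtain ⟨r, rfl⟩ := hpp
    have hPr : P = r ++ (a :: s ++ [a]) := by
      have : p' ++ P = p' ++ (r ++ (a :: s ++ [a])) := by simpa using hp'
      exact List.append_cancel_left this
    have hPr' : P = a :: s.reverse ++ a :: r.reverse := by
      rw [← hP2, hPr]; simp
    have hw : p' ++ r ++ a :: s ++ a :: q = p' ++ a :: s.reverse ++ a :: (r.reverse ++ q) := by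
      have : p' ++ r ++ a :: s ++ a :: q = p' ++ P ++ q := by rw [hPr]; simp
      rw [this, hPr']; simp
    rw [hw]
    refine ih p'.length (by omega) p' s.reverse _ rfl (by simpa using has) ?_
    intro h; apply hs; simpa using h.symm
  · have hpp : p <+: p' := by
      have e1 : p' <+: p ++ (a :: s ++ [a]) := ⟨P, by simpa using hp'⟩
      exact List.prefix_of_prefix_length_le (List.prefix_append _ _) e1 hge
    obtain ⟨r, rfl⟩ := hpp
    have hr : r ++ P = a :: s ++ [a] := by
      have : p ++ (r ++ P) = p ++ (a :: s ++ [a]) := by simpa using hp'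
      exact List.append_cancel_left this
    have hPa : P = [a] := by
      cases r with
      | nil =>
        exfalso
        apply hs
        have h : P = a :: s ++ [a] := by simpa using hr
        rw [h] at hP2
        simpa using hP2
      | cons b r =>
        have h : r ++ P = s ++ [a] := by
          have := hr
          simp at this
          exact this.2
        rcases List.eq_nil_or_concat' P with h0 | ⟨P', d, rfl⟩
        · exact absurd h0 hP1
        · rw [← List.append_assoc] at h
          obtain ⟨h5, h6⟩ := List.append_inj' h rfl
          cases P' with
          | nil => simpa using h6
          | cons e P' =>
            exfalso
            have hd : d = a := by simpa using h6
            have : e = d := by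
              have := hP2
              simp at this
              exact this.1.symm
            apply has
            rw [← h5, ← hd, ← this]; simp
    have hsub' : palSet (p ++ a :: s ++ [a]) ⊆ palSet (p ++ a :: s) := by
      intro x hx
      rcases hsub hx with h | h
      · rw [h, hPa]
        exact ⟨by simp, by simp, ⟨p, s, by simp⟩⟩
      · exact h
    have h1 := Set.ncard_le_ncard hsub' (palSet_finite _)
    have h2 := palSet_ncard_le (p ++ a :: s)
    have h3 := palSet_ncard_append (p ++ a :: s ++ [a]) q
    have h4 : p ++ a :: s ++ [a] ++ q = p ++ a :: s ++ a :: q := by simp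
    rw [h4] at h3
    simp only [List.length_append, List.length_cons] at *
    omega

/-- All palindromes of the three-armed star. -/
def triPal {α : Type*} (x y z : List α) : Set (List α) :=
  palSet (x.reverse ++ y) ∪ palSet (x.reverse ++ z) ∪ palSet (y.reverse ++ z)

theorem palSet_swap {α : Type*} (x y : List α) :
    palSet (x.reverse ++ y) = palSet (y.reverse ++ x) := by
  rw [← palSet_reverse]; simp

theorem triPal_swap12 {α : Type*} (x y z : List α) : triPal x y z = triPal y x z := by
  unfold triPal
  rw [palSet_swap x y, Set.union_right_comm]

theorem triPal_swap23 {α : Type*} (x y z : List α) : triPal x y z = triPal x z y := by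
  unfold triPal
  rw [palSet_swap y z, Set.union_comm (palSet (x.reverse ++ y))]

theorem tri_base {α : Type*} (x y z : List α) :
    (triPal x y z).ncard ≤ (palSet (x.reverse ++ y)).ncard + 2 * z.length := by
  have h1 := palSet_append_of_subset (palSet_finite (x.reverse ++ y)) (u := x.reverse)
    (palSet_mono (List.prefix_append _ _).isInfix) z
  have h2 := palSet_append_of_subset
    ((palSet_finite (x.reverse ++ y)).union (palSet_finite (x.reverse ++ z))) (u := y.reverse)
    (by
      rw [palSet_reverse]
      exact (palSet_mono (List.suffix_append _ _).isInfix).trans Set.subset_union_left) z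
  unfold triPal
  omega

/-- Saving one: the first letter of `z` gives nothing new with `y`. -/
theorem tri_save {α : Type*} (x y : List α) (c : α) (z : List α)
    (h : palSet (y.reverse ++ [c]) ⊆ palSet (x.reverse ++ y) ∪ palSet (x.reverse ++ c :: z)) :
    (triPal x y (c :: z)).ncard ≤ x.length + y.length + 2 * z.length + 1 := by
  have h0 := palSet_ncard_le (x.reverse ++ y)
  have h1 := palSet_append_of_subset (palSet_finite (x.reverse ++ y)) (u := x.reverse)
    (palSet_mono (List.prefix_append _ _).isInfix) (c :: z)
  have h2 := palSet_append_of_subset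
    ((palSet_finite (x.reverse ++ y)).union (palSet_finite (x.reverse ++ c :: z))) h z
  have e : y.reverse ++ [c] ++ z = y.reverse ++ c :: z := by simp
  rw [e] at h2
  unfold triPal
  simp only [List.length_append, List.length_cons, List.length_reverse] at *
  omega

/-- Two arms with the same first letter. -/
theorem tri_eq {α : Type*} (c : α) (x y z : List α) :
    (triPal (c :: x) y (c :: z)).ncard ≤ (x.length + 1) + y.length + 2 * z.length + 1 := by
  refine tri_save (c :: x) y c z ?_
  refine Set.Subset.trans ?_ Set.subset_union_left
  rw [palSet_swap (c :: x) y]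
  exact palSet_mono (List.IsPrefix.isInfix ⟨x, by simp⟩)

/-- The first letter of one arm is missing from another. -/
theorem tri_notMem {α : Type*} (c : α) (x y z : List α) (h : c ∉ y) :
    (triPal x y (c :: z)).ncard ≤ x.length + y.length + 2 * z.length + 1 := by
  refine tri_save x y c z ?_
  obtain ⟨q, hq0, hq1, hq2, hq⟩ := palSet_snoc y.reverse c
  have hqc : q = [c] := by
    rcases List.eq_nil_or_concat' q with h0 | ⟨q', d, rfl⟩
    · exact absurd h0 hq0
    · obtain ⟨s, hs⟩ := hq2
      rw [← List.append_assoc] at hs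
      obtain ⟨h5, h6⟩ := List.append_inj' hs rfl
      cases q' with
      | nil => simpa using h6
      | cons e q' =>
        exfalso
        have hd : d = c := by simpa using h6
        have he : e = d := by
          have := hq1
          simp at this
          exact this.1.symm
        apply h
        rw [← List.mem_reverse, ← h5, ← hd, ← he]; simp
  intro p hp
  rcases hq hp with h | h
  · right
    rw [h, hqc]
    exact ⟨by simp, by simp, ⟨x.reverse, z, by simp⟩⟩
  · left
    rw [palSet_reverse] at h
    exact palSet_mono (List.suffix_append _ _).isInfix h

theorem exists_first {α : Type*} (a : α) (y : List α) (h : a ∈ y) :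
    ∃ v r, y = v ++ a :: r ∧ a ∉ v := by
  obtain ⟨v, r, h1, h2⟩ := List.eq_append_cons_of_mem h
  exact ⟨v, r, h1, h2⟩

theorem tri_bound {α : Type*} (n : ℕ) (x y z : List α)
    (hx : x.length = n) (hy : y.length = n) (hz : z.length = n) :
    (triPal x y z).ncard ≤ 4 * n - 1 := by
  rcases n with _ | n
  · have h1 := tri_base x y z
    have h2 := palSet_ncard_le (x.reverse ++ y)
    simp only [List.length_append, List.length_reverse] at h2
    omega
  obtain ⟨a, x, rfl⟩ := List.exists_cons_of_length_eq_add_one hx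
  obtain ⟨b, y, rfl⟩ := List.exists_cons_of_length_eq_add_one hy
  obtain ⟨c, z, rfl⟩ := List.exists_cons_of_length_eq_add_one hz
  simp only [List.length_cons] at hx hy hz
  by_cases hab : a = b
  · subst hab
    have := tri_eq a x (c :: z) y
    rw [triPal_swap23]
    simp only [List.length_cons] at this
    omega
  by_cases hac : a = c
  · subst hac
    have := tri_eq a x (b :: y) z
    simp only [List.length_cons] at this
    omega
  by_cases hbc : b = c
  · subst hbc
    have := tri_eq b y (a :: x) z
    rw [triPal_swap12]
    simp only [List.length_cons] at this
    omega
  by_cases hay : a ∈ b :: y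
  swap
  · have := tri_notMem a (c :: z) (b :: y) x hay
    have e : triPal (c :: z) (b :: y) (a :: x) = triPal (a :: x) (b :: y) (c :: z) := by
      rw [triPal_swap12, triPal_swap23, triPal_swap12]
    rw [e] at this
    simp only [List.length_cons] at this
    omega
  by_cases haz : a ∈ c :: z
  swap
  · have := tri_notMem a (b :: y) (c :: z) x haz
    have e : triPal (b :: y) (c :: z) (a :: x) = triPal (a :: x) (b :: y) (c :: z) := by
      rw [triPal_swap23, triPal_swap12]
    rw [e] at this
    simp only [List.length_cons] at this
    omega
  obtain ⟨v, r, hv, hav⟩ := exists_first a _ hay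
  obtain ⟨t, s, ht, hat⟩ := exists_first a _ haz
  have hvl := congrArg List.length hv
  have htl := congrArg List.length ht
  simp only [List.length_cons, List.length_append] at hvl htl
  by_cases pv : v.reverse = v
  swap
  · have h1 := not_rich a _ r.reverse v.reverse x rfl (by simpa using hav)
      (by intro h; apply pv; simpa using h.symm)
    have h2 := tri_base (b :: y) (a :: x) (c :: z)
    have e : (b :: y).reverse ++ a :: x = r.reverse ++ a :: v.reverse ++ a :: x := by
      rw [hv]; simp
    rw [e, triPal_swap12] at h2
    simp only [List.length_cons, List.length_append, List.length_reverse] at h1 h2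
    omega
  by_cases pt : t.reverse = t
  swap
  · have h1 := not_rich a _ s.reverse t.reverse x rfl (by simpa using hat)
      (by intro h; apply pt; simpa using h.symm)
    have h2 := tri_base (c :: z) (a :: x) (b :: y)
    have e : (c :: z).reverse ++ a :: x = s.reverse ++ a :: t.reverse ++ a :: x := by
      rw [ht]; simp
    rw [e, triPal_swap12, triPal_swap23] at h2
    simp only [List.length_cons, List.length_append, List.length_reverse] at h1 h2
    omega
  by_cases pvt : (v.reverse ++ t).reverse = v.reverse ++ t
  swap
  · have h1 := not_rich a _ r.reverse (v.reverse ++ t) s rfl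
      (by simp [hav, hat]) pvt
    have h2 := tri_base (b :: y) (c :: z) (a :: x)
    have e : (b :: y).reverse ++ c :: z = r.reverse ++ a :: (v.reverse ++ t) ++ a :: s := by
      rw [hv, ht]; simp
    have e' : triPal (b :: y) (c :: z) (a :: x) = triPal (a :: x) (b :: y) (c :: z) := by
      rw [triPal_swap23, triPal_swap12]
    rw [e, e'] at h2
    simp only [List.length_cons, List.length_append, List.length_reverse] at h1 h2
    omega
  exfalso
  rw [List.reverse_append, List.reverse_reverse, pv, pt] at pvt
  cases v with
  | nil => simp at hv; exact hab hv.1.symm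
  | cons b' v =>
    cases t with
    | nil => simp at ht; exact hac ht.1.symm
    | cons c' t =>
      simp at hv ht pvt
      exact hbc (hv.1.trans (pvt.1.symm.trans ht.1.symm))

/-- Let x, y, z be words of length n with y[n] = z[n]. Then the number of distinct
non-empty palindromes occurring as factors of at least one of R(x)y, R(y)z, R(x)z is
at most 4n - 1. -/
theorem stmt_19 {α : Type*} (n : ℕ) (x y z : List α)
    (hx : x.length = n) (hy : y.length = n) (hz : z.length = n)
    (hlast : y.getLast? = z.getLast?) :
    {p : List α | p ≠ [] ∧ p.reverse = p ∧
        (p <:+: x.reverse ++ y ∨ p <:+: y.reverse ++ z ∨ p <:+: x.reverse ++ z)}.ncard ≤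
      4 * n - 1 := by
  have h := tri_bound n x y z hx hy hz
  have e : {p : List α | p ≠ [] ∧ p.reverse = p ∧
      (p <:+: x.reverse ++ y ∨ p <:+: y.reverse ++ z ∨ p <:+: x.reverse ++ z)} =
      triPal x y z := by
    ext p
    simp only [triPal, palSet, Set.mem_union, Set.mem_ofPred_eq]
    tauto
  rw [e]
  exact h
end
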